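/- Let J be a monomial ideal of S. Then J is a Cartwright-Sturmfels* ideal if and only if the sequence Γ = {x_{ij} − x_{i1} : 1 ≤ i ≤ v, 2 ≤ j ≤ n_i} is a regular sequence on S/J. -/

import Mathlib

open MvPolynomial

noncomputable section

namespace CSPaper

/-- The set of variables of the standard `ℤ^v`-graded polynomial ring `S`:
the variable `x_{i j}` of the paper (with `1 ≤ i ≤ v`, `1 ≤ j ≤ n_i`) corresponds to
`⟨i-1, j-1⟩ : MVar v n` where `n (i-1) = n_i - 1`; thus row `i` has `n i + 1 > 0`
variables and the first variable `x_{i 1}` of row `i` corresponds to `⟨i, 0⟩`. -/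
abbrev MVar (v : ℕ) (n : Fin v → ℕ) : Type := Σ i : Fin v, Fin (n i + 1)

/-- The weight function giving the standard `ℤ^v`-grading: `deg (x_{i j}) = e_i ∈ ℤ^v`. -/
def wt (v : ℕ) (n : Fin v → ℕ) : MVar v n → (Fin v → ℕ) := fun p => Pi.single p.1 1

variable {K : Type} [Field K] {v : ℕ} {n : Fin v → ℕ}

/-- An ideal of `S` is `ℤ^v`-graded (multigraded) iff it contains every multihomogeneous
component of each of its elements. -/
def IsMultigraded (I : Ideal (MvPolynomial (MVar v n) K)) : Prop :=
  ∀ f ∈ I, ∀ a : Fin v → ℕ, weightedHomogeneousComponent (wt v n) a f ∈ I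

/-- The value of the `ℤ^v`-graded Hilbert function of the ideal `I` at `a ∈ ℕ^v`:
`dim_K I_a`. -/
def hilb (I : Ideal (MvPolynomial (MVar v n) K)) (a : Fin v → ℕ) : ℕ :=
  Module.finrank K
    ((Submodule.restrictScalars K I ⊓ weightedHomogeneousSubmodule K (wt v n) a :
      Submodule K (MvPolynomial (MVar v n) K)))

/-- Two ideals have the same `ℤ^v`-graded Hilbert series. -/
def sameHS (I J : Ideal (MvPolynomial (MVar v n) K)) : Prop :=
  ∀ a : Fin v → ℕ, hilb I a = hilb J a

/-- The `ℤ^v`-graded `K`-algebra endomorphism of `S` determined by a `v`-tuple of square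
matrices: `x_{i j} ↦ ∑_k (g i)_{k j} x_{i k}`.  For invertible `g i` these are exactly the
elements of `G = GL_{n_1}(K) × ⋯ × GL_{n_v}(K)` acting on `S`. -/
def gAct (g : ∀ i : Fin v, Matrix (Fin (n i + 1)) (Fin (n i + 1)) K) :
    MvPolynomial (MVar v n) K →ₐ[K] MvPolynomial (MVar v n) K :=
  aeval fun p : MVar v n => ∑ k : Fin (n p.1 + 1), C (g p.1 k p.2) * X ⟨p.1, k⟩

/-- A property `P` of `v`-tuples of matrices holds generically (i.e. for a general
`g ∈ GL_{n_1}(K) × ⋯ × GL_{n_v}(K)`) if there is a nonzero polynomial `h` in the matrix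
entries such that `P g` holds for every invertible `g` with `h(g) ≠ 0`. -/
def Generically
    (P : (∀ i : Fin v, Matrix (Fin (n i + 1)) (Fin (n i + 1)) K) → Prop) : Prop :=
  ∃ h : MvPolynomial (Σ i : Fin v, Fin (n i + 1) × Fin (n i + 1)) K, h ≠ 0 ∧
    ∀ g : ∀ i : Fin v, Matrix (Fin (n i + 1)) (Fin (n i + 1)) K,
      (∀ i, IsUnit (g i).det) →
      eval (fun q : Σ i : Fin v, Fin (n i + 1) × Fin (n i + 1) => g q.1 q.2.1 q.2.2) h ≠ 0 →
      P g

/-- The leading exponent (exponent of the leading monomial) of a polynomial with respect to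
a term order `τ` (a `MonomialOrder`); by convention `leadExp τ 0 = 0`. -/
def leadExp (τ : MonomialOrder (MVar v n)) (f : MvPolynomial (MVar v n) K) :
    MVar v n →₀ ℕ :=
  τ.toSyn.symm (f.support.sup τ.toSyn)

/-- The initial ideal `in_τ(I)`: the monomial ideal generated by the leading monomials of the
nonzero elements of `I`. -/
def inIdeal (τ : MonomialOrder (MVar v n)) (I : Ideal (MvPolynomial (MVar v n) K)) :
    Ideal (MvPolynomial (MVar v n) K) :=
  Ideal.span {m | ∃ f ∈ I, f ≠ 0 ∧ m = monomial (leadExp τ f) (1 : K)}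

/-- `G` is a Gröbner basis of `I` with respect to the term order `τ`. -/
def IsGroebnerBasis (τ : MonomialOrder (MVar v n)) (G : Set (MvPolynomial (MVar v n) K))
    (I : Ideal (MvPolynomial (MVar v n) K)) : Prop :=
  G ⊆ (I : Set (MvPolynomial (MVar v n) K)) ∧
    Ideal.span ((fun f => monomial (leadExp τ f) (1 : K)) '' {f ∈ G | f ≠ 0}) = inIdeal τ I

/-- `J = gin_τ(I)`, the `ℤ^v`-graded generic initial ideal: for a general
`g ∈ GL_{n_1}(K) × ⋯ × GL_{n_v}(K)` one has `in_τ(g(I)) = J`. -/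
def IsGin (τ : MonomialOrder (MVar v n)) (I J : Ideal (MvPolynomial (MVar v n) K)) : Prop :=
  Generically fun g => inIdeal τ (Ideal.map (gAct g) I) = J

/-- A term order such that `x_{i j} > x_{i k}` whenever `j < k`. -/
def RespectsVarOrder (τ : MonomialOrder (MVar v n)) : Prop :=
  ∀ (i : Fin v) (j k : Fin (n i + 1)), j < k →
    τ.toSyn (Finsupp.single (⟨i, k⟩ : MVar v n) 1) <
      τ.toSyn (Finsupp.single (⟨i, j⟩ : MVar v n) 1)

/-- An ideal is Borel fixed if it is fixed by every element of the Borel subgroup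
`B = B_{n_1}(K) × ⋯ × B_{n_v}(K)` of upper triangular invertible matrices (upper triangular
with respect to the order `x_{i 1} > x_{i 2} > ⋯` of the variables in each row). -/
def BorelFixed (I : Ideal (MvPolynomial (MVar v n) K)) : Prop :=
  ∀ g : ∀ i : Fin v, Matrix (Fin (n i + 1)) (Fin (n i + 1)) K,
    (∀ i, IsUnit (g i).det) →
    (∀ (i : Fin v) (k j : Fin (n i + 1)), j < k → g i k j = 0) →
    Ideal.map (gAct g) I = I

/-- A Cartwright-Sturmfels ideal: a `ℤ^v`-graded ideal with the same `ℤ^v`-graded Hilbert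
series as some radical Borel fixed ideal. -/
def IsCS (I : Ideal (MvPolynomial (MVar v n) K)) : Prop :=
  IsMultigraded I ∧ ∃ J : Ideal (MvPolynomial (MVar v n) K),
    J.IsRadical ∧ BorelFixed J ∧ sameHS I J

/-- The exponent of the monomial `x_{1 1}^{a 1} ⋯ x_{v 1}^{a v}` of
`T = K[x_{1 1}, …, x_{v 1}] ⊆ S`. -/
def Tmono (v : ℕ) (n : Fin v → ℕ) (a : Fin v → ℕ) : MVar v n →₀ ℕ :=
  ∑ i : Fin v, Finsupp.single (⟨i, 0⟩ : MVar v n) (a i)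

/-- A `ℤ^v`-graded ideal of `S` extended from `T`, i.e. generated by monomials in the
variables `x_{1 1}, …, x_{v 1}`. -/
def ExtendedFromT (J : Ideal (MvPolynomial (MVar v n) K)) : Prop :=
  ∃ A : Set (Fin v → ℕ),
    J = Ideal.span ((fun a => monomial (Tmono v n a) (1 : K)) '' A)

/-- A Cartwright-Sturmfels* ideal: a `ℤ^v`-graded ideal with the same `ℤ^v`-graded Hilbert
series as some ideal extended from `T`. -/
def IsCSstar (J : Ideal (MvPolynomial (MVar v n) K)) : Prop :=
  IsMultigraded J ∧ ∃ C : Ideal (MvPolynomial (MVar v n) K), ExtendedFromT C ∧ sameHS J C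

/-- A monomial ideal. -/
def IsMonomialIdeal (I : Ideal (MvPolynomial (MVar v n) K)) : Prop :=
  ∃ A : Set (MVar v n →₀ ℕ), I = Ideal.span ((fun s => monomial s (1 : K)) '' A)

/-- A squarefree monomial ideal. -/
def IsSqfreeMonomialIdeal (I : Ideal (MvPolynomial (MVar v n) K)) : Prop :=
  ∃ A : Set (MVar v n →₀ ℕ), (∀ s ∈ A, ∀ x, s x ≤ 1) ∧
    I = Ideal.span ((fun s => monomial s (1 : K)) '' A)

/-- `J` is the Alexander dual of the squarefree monomial ideal `I`: `J` is generated by the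
products `∏_{x ∈ P} x` as `P` ranges over the minimal primes of `I`. -/
def IsAlexanderDual (I J : Ideal (MvPolynomial (MVar v n) K)) : Prop :=
  J = Ideal.span {m | ∃ F : Finset (MVar v n),
    Ideal.span ((fun x => (X x : MvPolynomial (MVar v n) K)) '' ↑F) ∈ I.minimalPrimes ∧
    m = ∏ x ∈ F, X x}

/-- The sequence `x_{i j} - λ_{i j} x_{i 1}`, `1 ≤ i ≤ v`, `2 ≤ j ≤ n_i`, as a list. -/
def LamList (lam : MVar v n → K) : List (MvPolynomial (MVar v n) K) :=
  (List.finRange v).flatMap fun i =>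
    ((List.finRange (n i + 1)).drop 1).map fun j =>
      X (⟨i, j⟩ : MVar v n) - C (lam ⟨i, j⟩) * X (⟨i, 0⟩ : MVar v n)

/-- A property of the scalars `λ = (λ_{i j})` holds for general `λ ∈ K^N` if there is a
nonzero polynomial `h` in the `λ_{i j}` such that the property holds whenever `h(λ) ≠ 0`. -/
def GenericallyLam {v : ℕ} {n : Fin v → ℕ} (K : Type) [Field K]
    (P : (MVar v n → K) → Prop) : Prop :=
  ∃ h : MvPolynomial (MVar v n) K, h ≠ 0 ∧
    ∀ lam : MVar v n → K, eval lam h ≠ 0 → P lam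

variable {K : Type} [Field K] {v : ℕ} {n : Fin v → ℕ}

/-- A graded free resolution of an ideal `I` of a polynomial ring graded by an additive
monoid `M` via a weight function `w` on the variables:
`⋯ → F_2 → F_1 → F_0 → I → 0`, where `F_p` is the free module with (finite) basis `ι p`,
the basis element `i : ι p` having degree `deg p i ∈ M`, all maps are graded of degree `0`,
and the complex is exact. -/
structure GradedFreeResolution (σ : Type) (K : Type) [Field K] (M : Type) [AddCommMonoid M]
    (w : σ → M) (I : Ideal (MvPolynomial σ K)) where
  ι : ℕ → Type
  finite : ∀ p, Finite (ι p)
  deg : ∀ p, ι p → M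
  aug : (ι 0 →₀ MvPolynomial σ K) →ₗ[MvPolynomial σ K] MvPolynomial σ K
  d : ∀ p, (ι (p + 1) →₀ MvPolynomial σ K) →ₗ[MvPolynomial σ K] (ι p →₀ MvPolynomial σ K)
  aug_graded : ∀ i : ι 0, (aug (Finsupp.single i 1)).IsWeightedHomogeneous w (deg 0 i)
  d_graded : ∀ (p : ℕ) (i : ι (p + 1)) (j : ι p),
    (d p (Finsupp.single i 1)) j = 0 ∨
      ∃ b, ((d p (Finsupp.single i 1)) j).IsWeightedHomogeneous w b ∧
        b + deg p j = deg (p + 1) i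
  range_aug : LinearMap.range aug = (I : Submodule (MvPolynomial σ K) (MvPolynomial σ K))
  exact_zero : LinearMap.ker aug = LinearMap.range (d 0)
  exact : ∀ p, LinearMap.ker (d p) = LinearMap.range (d (p + 1))

/-- A graded free resolution is minimal if all entries of the matrices of the differentials
between free modules lie in the irrelevant maximal ideal, i.e. have zero constant term. -/
def GradedFreeResolution.Minimal {σ M : Type} [AddCommMonoid M] {w : σ → M}
    {I : Ideal (MvPolynomial σ K)} (F : GradedFreeResolution σ K M w I) : Prop :=
  ∀ (p : ℕ) (i : F.ι (p + 1)) (j : F.ι p),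
    MvPolynomial.constantCoeff ((F.d p (Finsupp.single i 1)) j) = 0

/-- The graded Betti number `β_{p,a}` read off from a (minimal) graded free resolution:
the number of basis elements of `F_p` of degree `a`. -/
def GradedFreeResolution.betti {σ M : Type} [AddCommMonoid M] {w : σ → M}
    {I : Ideal (MvPolynomial σ K)} (F : GradedFreeResolution σ K M w I) (p : ℕ) (a : M) :
    ℕ :=
  Nat.card {i : F.ι p // F.deg p i = a}

/-- The set of `t × t` minors of the matrix `A`. -/
def minorsSet {R : Type} [CommRing R] (t : ℕ) {m N : ℕ} (A : Matrix (Fin m) (Fin N) R) :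
    Set R :=
  {d | ∃ (r : Fin t → Fin m) (c : Fin t → Fin N),
    Function.Injective r ∧ Function.Injective c ∧ d = (A.submatrix r c).det}

/-- `I_t(A)`, the ideal generated by the `t × t` minors of `A`. -/
def minorsIdeal {R : Type} [CommRing R] (t : ℕ) {m N : ℕ}
    (A : Matrix (Fin m) (Fin N) R) : Ideal R :=
  Ideal.span (minorsSet t A)

/-- `A` is column-graded: `N ≤ v` and each entry of the `j`-th column is either `0` or
multihomogeneous of degree `e_j ∈ ℤ^v`. -/
def ColumnGraded {m N : ℕ} (A : Matrix (Fin m) (Fin N) (MvPolynomial (MVar v n) K)) :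
    Prop :=
  ∃ h : N ≤ v, ∀ i j, A i j = 0 ∨
    (A i j).IsWeightedHomogeneous (wt v n) (Pi.single (Fin.castLE h j) 1)

/-- `A` is row-graded: `m ≤ v` and each entry of the `i`-th row is either `0` or
multihomogeneous of degree `e_i ∈ ℤ^v`. -/
def RowGraded {m N : ℕ} (A : Matrix (Fin m) (Fin N) (MvPolynomial (MVar v n) K)) : Prop :=
  ∃ h : m ≤ v, ∀ i j, A i j = 0 ∨
    (A i j).IsWeightedHomogeneous (wt v n) (Pi.single (Fin.castLE h i) 1)

/-- The exponent of the polarization of the monomial `x_{1 1}^{a 1} ⋯ x_{v 1}^{a v}` of `T`: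
the squarefree monomial `∏_i x_{i 1} x_{i 2} ⋯ x_{i (a i)}`. -/
def polExp (v : ℕ) (n : Fin v → ℕ) (a : Fin v → ℕ) : MVar v n →₀ ℕ :=
  ∑ i : Fin v, ∑ j ∈ Finset.univ.filter (fun j : Fin (n i + 1) => (j : ℕ) < a i),
    Finsupp.single (⟨i, j⟩ : MVar v n) 1

/-- `P = pol(C)`, the polarization of an ideal `C` extended from `T`
(the exponents of the generators of `C` must fit inside `S`). -/
def IsPolarizationOfT (C P : Ideal (MvPolynomial (MVar v n) K)) : Prop :=
  ∃ A : Set (Fin v → ℕ), (∀ a ∈ A, ∀ i, a i ≤ n i + 1) ∧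
    C = Ideal.span ((fun a => monomial (Tmono v n a) (1 : K)) '' A) ∧
    P = Ideal.span ((fun a => monomial (polExp v n a) (1 : K)) '' A)

/-- `ψ` is an identification of the quotient of `S` by the `ℤ^v`-graded ideal `Q` with a
standard `ℤ^v`-graded polynomial ring, compatible with the gradings. -/
def IsGradedStructureIso {n₂ : Fin v → ℕ} (Q : Ideal (MvPolynomial (MVar v n) K))
    (ψ : (MvPolynomial (MVar v n) K ⧸ Q) ≃ₐ[K] MvPolynomial (MVar v n₂) K) : Prop :=
  ∀ (f : MvPolynomial (MVar v n) K) (a : Fin v → ℕ),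
    f.IsWeightedHomogeneous (wt v n) a →
      (ψ (Ideal.Quotient.mk Q f)).IsWeightedHomogeneous (wt v n₂) a

end CSPaper

open CSPaper

namespace CSPaper

section HilbertFunction

variable {K : Type} [Field K] {v : ℕ} {n : Fin v → ℕ}

local notation "S" => MvPolynomial (MVar v n) K

theorem weight_wt_apply (s : MVar v n →₀ ℕ) (i : Fin v) :
    Finsupp.weight (wt v n) s i = ∑ j : Fin (n i + 1), s ⟨i, j⟩ := by
  rw [Finsupp.weight_apply, Finsupp.sum_fintype _ _ (by simp), Finset.sum_apply,
    Fintype.sum_sigma, Finset.sum_eq_single i]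
  · simp [wt]
  · intro k _ hk
    simp [wt, Pi.single_eq_of_ne hk.symm]
  · simp

theorem finite_setOf_weight_wt_eq (a : Fin v → ℕ) :
    {s : MVar v n →₀ ℕ | Finsupp.weight (wt v n) s = a}.Finite := by
  refine (Set.finite_Iic (Finsupp.equivFunOnFinite.symm fun p : MVar v n => a p.1)).subset ?_
  rintro s rfl ⟨i, j⟩
  simpa [weight_wt_apply] using
    Finset.single_le_sum (f := fun j => s ⟨i, j⟩) (fun _ _ => Nat.zero_le _) (Finset.mem_univ j)

instance finite_weightedHomogeneousSubmodule_wt (a : Fin v → ℕ) :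
    Module.Finite K (weightedHomogeneousSubmodule K (wt v n) a) := by
  rw [weightedHomogeneousSubmodule_eq_finsupp_supported]
  have := (finite_setOf_weight_wt_eq (n := n) a).to_subtype
  exact Module.Finite.of_basis (basisRestrictSupport K {d | Finsupp.weight (wt v n) d = a})

instance finite_inf_weightedHomogeneousSubmodule (N : Submodule K S) (a : Fin v → ℕ) :
    Module.Finite K (N ⊓ weightedHomogeneousSubmodule K (wt v n) a : Submodule K S) :=
  Submodule.finiteDimensional_of_le inf_le_right

theorem hilb_mono {I I' : Ideal S} (h : I ≤ I') (a : Fin v → ℕ) : hilb I a ≤ hilb I' a :=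
  Submodule.finrank_mono (inf_le_inf_right _ fun _ hx => h hx)

theorem mem_of_forall_component_mem {I : Ideal S} {f : S}
    (h : ∀ a, weightedHomogeneousComponent (wt v n) a f ∈ I) : f ∈ I := by
  rw [← sum_weightedHomogeneousComponent (wt v n) f,
    finsum_eq_sum _ (weightedHomogeneousComponent_finsupp f)]
  exact Ideal.sum_mem _ fun a _ => h a

theorem IsMultigraded.le_of_hilb_eq {I I' : Ideal S} (hI' : IsMultigraded I') (h : I ≤ I')
    (heq : ∀ a, hilb I' a = hilb I a) : I' = I := by
  refine le_antisymm (fun f hf => mem_of_forall_component_mem fun a => ?_) h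
  have := Submodule.eq_of_le_of_finrank_eq
    (inf_le_inf_right (weightedHomogeneousSubmodule K (wt v n) a)
      (show I.restrictScalars K ≤ I'.restrictScalars K from fun _ hx => h hx)) (heq a).symm
  have hm : weightedHomogeneousComponent (wt v n) a f ∈
      I'.restrictScalars K ⊓ weightedHomogeneousSubmodule K (wt v n) a :=
    ⟨hI' f hf a, weightedHomogeneousComponent_mem _ _ _⟩
  rw [← this] at hm
  exact hm.1

theorem component_add_mul {l : S} {e : Fin v → ℕ} (hl : l.IsWeightedHomogeneous (wt v n) e)
    (b : Fin v → ℕ) (f : S) :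
    weightedHomogeneousComponent (wt v n) (b + e) (l * f) =
      l * weightedHomogeneousComponent (wt v n) b f := by
  induction f using MvPolynomial.induction_on' with
  | add p q hp hq => simp only [mul_add, map_add, hp, hq]
  | monomial s c =>
    have hs := isWeightedHomogeneous_monomial (wt v n) s c rfl
    have hls := hl.mul hs
    by_cases hb : b = Finsupp.weight (wt v n) s
    · subst hb
      rw [hs.weightedHomogeneousComponent_same, add_comm, hls.weightedHomogeneousComponent_same]
    · rw [hs.weightedHomogeneousComponent_ne _ hb, mul_zero]
      refine hls.weightedHomogeneousComponent_ne _ fun h => hb ?_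
      rw [add_comm] at h
      exact add_left_cancel h

theorem component_mul_eq_zero {l : S} {e : Fin v → ℕ}
    (hl : l.IsWeightedHomogeneous (wt v n) e) {a : Fin v → ℕ} (ha : ¬ e ≤ a) (f : S) :
    weightedHomogeneousComponent (wt v n) a (l * f) = 0 := by
  induction f using MvPolynomial.induction_on' with
  | add p q hp hq => rw [mul_add, map_add, hp, hq, add_zero]
  | monomial s c =>
    refine (hl.mul (isWeightedHomogeneous_monomial (wt v n) s c rfl)).weightedHomogeneousComponent_ne
      _ fun h => ha ?_
    rw [h]
    exact le_self_add

theorem IsMultigraded.sup_span_singleton {I : Ideal S} (hI : IsMultigraded I) {l : S}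
    {e : Fin v → ℕ} (hl : l.IsWeightedHomogeneous (wt v n) e) :
    IsMultigraded (I ⊔ Ideal.span {l}) := by
  intro f hf a
  obtain ⟨g, hg, h, hh, rfl⟩ := Submodule.mem_sup.mp hf
  obtain ⟨q, rfl⟩ := Ideal.mem_span_singleton.mp hh
  rw [map_add]
  refine add_mem (Ideal.mem_sup_left (hI g hg a)) (Ideal.mem_sup_right ?_)
  by_cases ha : e ≤ a
  · obtain ⟨b, rfl⟩ := exists_add_of_le ha
    rw [add_comm, component_add_mul hl]
    exact Ideal.mul_mem_right _ _ (Ideal.mem_span_singleton_self l)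
  · rw [component_mul_eq_zero hl ha]
    exact zero_mem _

/-- The colon ideal `I : l`. -/
def colonBy (I : Ideal S) (l : S) : Ideal S := Submodule.comap (LinearMap.mulLeft S l) I

theorem mem_colonBy {I : Ideal S} {l f : S} : f ∈ colonBy I l ↔ l * f ∈ I := Iff.rfl

theorem le_colonBy (I : Ideal S) (l : S) : I ≤ colonBy I l := fun _ hf => I.mul_mem_left l hf

theorem IsMultigraded.colonBy {I : Ideal S} (hI : IsMultigraded I) {l : S}
    {e : Fin v → ℕ} (hl : l.IsWeightedHomogeneous (wt v n) e) :
    IsMultigraded (colonBy I l) := by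
  intro f hf b
  rw [mem_colonBy, ← component_add_mul hl]
  exact hI _ hf _

theorem hilb_sup_span_singleton_of_not_le {I : Ideal S} (hI : IsMultigraded I) {l : S}
    {e : Fin v → ℕ} (hl : l.IsWeightedHomogeneous (wt v n) e) {a : Fin v → ℕ} (ha : ¬ e ≤ a) :
    hilb (I ⊔ Ideal.span {l}) a = hilb I a := by
  refine le_antisymm (Submodule.finrank_mono ?_) (hilb_mono le_sup_left a)
  rintro f ⟨hf, hfa⟩
  refine ⟨?_, hfa⟩
  obtain ⟨g, hg, h, hh, hgh⟩ := Submodule.mem_sup.mp hf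
  obtain ⟨q, rfl⟩ := Ideal.mem_span_singleton.mp hh
  have := congrArg (weightedHomogeneousComponent (wt v n) a) hgh
  rw [map_add, component_mul_eq_zero hl ha, add_zero,
    weightedHomogeneousComponent_eq_self hfa] at this
  rw [← this]
  exact hI g hg a

theorem hilb_sup_span_singleton_add {I : Ideal S} (hI : IsMultigraded I) {l : S} (hl0 : l ≠ 0)
    {e : Fin v → ℕ} (hl : l.IsWeightedHomogeneous (wt v n) e) (b : Fin v → ℕ) :
    hilb (I ⊔ Ideal.span {l}) (b + e) + hilb (colonBy I l) b =
      hilb I (b + e) + hilb (⊤ : Ideal S) b := by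
  have hinj : Function.Injective (LinearMap.mulLeft K l) := fun x y hxy =>
    mul_left_cancel₀ hl0 hxy
  have hrank (N : Submodule K S) :
      Module.finrank K (N.map (LinearMap.mulLeft K l)) = Module.finrank K N :=
    (Submodule.equivMapOfInjective _ hinj N).finrank_eq.symm
  have hsup : (I ⊔ Ideal.span {l}).restrictScalars K ⊓
      weightedHomogeneousSubmodule K (wt v n) (b + e) =
      (I.restrictScalars K ⊓ weightedHomogeneousSubmodule K (wt v n) (b + e)) ⊔
      ((⊤ : Ideal S).restrictScalars K ⊓ weightedHomogeneousSubmodule K (wt v n) b).map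
        (LinearMap.mulLeft K l) := by
    apply le_antisymm
    · rintro f ⟨hf, hfa⟩
      obtain ⟨g, hg, h, hh, hgh⟩ := Submodule.mem_sup.mp hf
      obtain ⟨q, rfl⟩ := Ideal.mem_span_singleton.mp hh
      have := congrArg (weightedHomogeneousComponent (wt v n) (b + e)) hgh
      rw [map_add, component_add_mul hl, weightedHomogeneousComponent_eq_self hfa] at this
      rw [← this]
      exact Submodule.add_mem_sup ⟨hI g hg _, weightedHomogeneousComponent_mem _ _ _⟩
        ⟨_, ⟨trivial, weightedHomogeneousComponent_mem _ q b⟩, rfl⟩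
    · refine sup_le (inf_le_inf_right _ fun _ hx => Ideal.mem_sup_left hx) ?_
      rintro _ ⟨q, ⟨-, hq⟩, rfl⟩
      refine ⟨Ideal.mem_sup_right (Ideal.mul_mem_right _ _ (Ideal.mem_span_singleton_self l)), ?_⟩
      rw [add_comm b e]
      exact hl.mul hq
  have hinf : (I.restrictScalars K ⊓ weightedHomogeneousSubmodule K (wt v n) (b + e)) ⊓
      ((⊤ : Ideal S).restrictScalars K ⊓ weightedHomogeneousSubmodule K (wt v n) b).map
        (LinearMap.mulLeft K l) =
      ((colonBy I l).restrictScalars K ⊓ weightedHomogeneousSubmodule K (wt v n) b).map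
        (LinearMap.mulLeft K l) := by
    apply le_antisymm
    · rintro _ ⟨⟨hf, -⟩, q, ⟨-, hq⟩, rfl⟩
      exact ⟨q, ⟨hf, hq⟩, rfl⟩
    · rintro _ ⟨q, ⟨hqI, hq⟩, rfl⟩
      refine ⟨⟨hqI, ?_⟩, q, ⟨trivial, hq⟩, rfl⟩
      rw [add_comm b e]
      exact hl.mul hq
  have := Submodule.finrank_sup_add_finrank_inf_eq
    (I.restrictScalars K ⊓ weightedHomogeneousSubmodule K (wt v n) (b + e))
    (((⊤ : Ideal S).restrictScalars K ⊓ weightedHomogeneousSubmodule K (wt v n) b).map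
      (LinearMap.mulLeft K l))
  rw [← hsup, hinf, hrank, hrank] at this
  exact this

end HilbertFunction

section WeaklyRegular

open RingTheory.Sequence Pointwise

theorem isWeaklyRegular_quotient_cons_iff {R : Type*} [CommRing R] (I : Ideal R) (r : R)
    (rs : List R) :
    IsWeaklyRegular (R ⧸ I) (r :: rs) ↔
      (∀ x, r * x ∈ I → x ∈ I) ∧ IsWeaklyRegular (R ⧸ I ⊔ Ideal.span {r}) rs := by
  rw [isWeaklyRegular_cons_iff]
  refine and_congr (isSMulRegular_quotient_iff_mem_of_smul_mem I r) ?_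
  have h : r • (⊤ : Submodule R (R ⧸ I)) =
      Submodule.map (Submodule.mkQ I) (Ideal.span {r}) := by
    rw [← Submodule.range_mkQ, ← Submodule.map_top, ← Submodule.map_pointwise_smul,
      ← Submodule.ideal_span_singleton_smul, smul_eq_mul, Ideal.mul_top]
  exact ((Submodule.quotEquivOfEq _ _ h).trans
    (Submodule.quotientQuotientEquivQuotientSup I (Ideal.span {r}))).isWeaklyRegular_congr rs

variable {K : Type} [Field K] {v : ℕ} {n : Fin v → ℕ}

local notation "S" => MvPolynomial (MVar v n) K

/-- Comparison of Hilbert functions along a sequence of multihomogeneous linear forms which is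
weakly regular modulo `I'`. -/
theorem hilb_le_and_sameHS_iff_isWeaklyRegular (L : List S)
    (hL : ∀ l ∈ L, l ≠ 0 ∧ ∃ i, l.IsWeightedHomogeneous (wt v n) (Pi.single i 1)) :
    ∀ {I I' : Ideal S}, IsMultigraded I → IsMultigraded I' → IsWeaklyRegular (S ⧸ I') L →
      I ⊔ Ideal.ofList L = I' ⊔ Ideal.ofList L →
      (∀ a, hilb I' a ≤ hilb I a) ∧ (sameHS I I' ↔ IsWeaklyRegular (S ⧸ I) L) := by
  induction L with
  | nil =>
    intro I I' _ _ _ h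
    obtain rfl : I = I' := by simpa using h
    exact ⟨fun _ => le_rfl, iff_of_true (fun _ => rfl) (by simp)⟩
  | cons l L ih =>
    intro I I' hI hI' hreg h
    obtain ⟨hl0, i, hl⟩ := hL l List.mem_cons_self
    rw [isWeaklyRegular_quotient_cons_iff] at hreg ⊢
    have hI'l : colonBy I' l = I' := le_antisymm hreg.1 (le_colonBy _ _)
    obtain ⟨hle, hiff⟩ := ih (fun l' hl' => hL l' (List.mem_cons_of_mem _ hl'))
      (hI.sup_span_singleton hl) (hI'.sup_span_singleton hl) hreg.2
      (by rw [sup_assoc, sup_assoc, ← Ideal.ofList_cons, h])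
    have F0 {a : Fin v → ℕ} (ha : ¬ Pi.single i 1 ≤ a) :=
      hilb_sup_span_singleton_of_not_le hI hl ha
    have F0' {a : Fin v → ℕ} (ha : ¬ Pi.single i 1 ≤ a) :=
      hilb_sup_span_singleton_of_not_le hI' hl ha
    have F := hilb_sup_span_singleton_add hI hl0 hl
    have F' := hilb_sup_span_singleton_add hI' hl0 hl
    rw [hI'l] at F'
    have degree_induction {P : (Fin v → ℕ) → Prop} (h0 : ∀ a, ¬ Pi.single i 1 ≤ a → P a)
        (h1 : ∀ b, P b → P (b + Pi.single i 1)) (a : Fin v → ℕ) : P a := by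
      induction hk : a i using Nat.strong_induction_on generalizing a with
      | _ k IH =>
        by_cases ha : Pi.single i 1 ≤ a
        · obtain ⟨b, rfl⟩ := exists_add_of_le ha
          rw [add_comm]
          refine h1 b (IH (b i) ?_ b rfl)
          simp [← hk]
        · exact h0 a ha
    have hle' : ∀ a, hilb I' a ≤ hilb I a := by
      refine degree_induction (fun a ha => ?_) fun b hb => ?_
      · rw [← F0 ha, ← F0' ha]
        exact hle a
      · have h1 := F b
        have h2 := F' b
        have h3 := hle (b + Pi.single i 1)
        have h4 := hilb_mono (le_colonBy I l) b
        lia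
    refine ⟨hle', fun hs => ?_, fun ⟨hr, hr'⟩ => ?_⟩
    · have key (b : Fin v → ℕ) : hilb (colonBy I l) b = hilb I b ∧
          hilb (I ⊔ Ideal.span {l}) (b + Pi.single i 1) =
            hilb (I' ⊔ Ideal.span {l}) (b + Pi.single i 1) := by
        have h1 := F b
        have h2 := F' b
        have h3 := hle (b + Pi.single i 1)
        have h4 := hilb_mono (le_colonBy I l) b
        have h5 := hs b
        have h6 := hs (b + Pi.single i 1)
        lia
      constructor
      · have := (hI.colonBy hl).le_of_hilb_eq (le_colonBy I l) fun b => (key b).1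
        exact fun x hx => this.le hx
      · refine hiff.mp (degree_induction (fun a ha => ?_) fun b _ => (key b).2)
        rw [F0 ha, F0' ha, hs a]
    · have hIl : colonBy I l = I := le_antisymm hr (le_colonBy _ _)
      have hs := hiff.mpr hr'
      rw [hIl] at F
      refine degree_induction (fun a ha => ?_) fun b hb => ?_
      · rw [← F0 ha, ← F0' ha, hs a]
      · have h1 := F b
        have h2 := F' b
        have h3 := hs (b + Pi.single i 1)
        lia

end WeaklyRegular

section Collapse

open RingTheory.Sequence

theorem mem_span_monomial_of_X_sub_X_mul_mem {σ R : Type*} [CommRing R] {A : Set (σ →₀ ℕ)}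
    {p q : σ} (hpq : p ≠ q) (hA : ∀ t ∈ A, t p = 0) {g : MvPolynomial σ R}
    (h : (X p - X q) * g ∈ Ideal.span ((fun s => monomial s (1 : R)) '' A)) :
    g ∈ Ideal.span ((fun s => monomial s (1 : R)) '' A) := by
  classical
  rw [mem_ideal_span_monomial_image] at h ⊢
  by_contra hne
  obtain ⟨s, hs, hmax⟩ := Finset.exists_max_image
    (g.support.filter fun s => ¬ ∃ t ∈ A, t ≤ s) (fun s => s p) (by
      push Not at hne
      obtain ⟨s, hs, hs'⟩ := hne
      exact ⟨s, Finset.mem_filter.mpr ⟨hs, by push Not; exact hs'⟩⟩)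
  obtain ⟨hs, hsA⟩ := Finset.mem_filter.mp hs
  suffices h' : ∃ t ∈ A, t ≤ s + Finsupp.single p 1 by
    obtain ⟨t, htA, ht⟩ := h'
    refine hsA ⟨t, htA, fun r => ?_⟩
    by_cases hr : r = p
    · subst hr
      simp [hA t htA]
    · simpa [Finsupp.single_eq_of_ne hr] using ht r
  have hcoeff : coeff (s + Finsupp.single p 1) ((X p - X q) * g) =
      coeff s g - coeff (s + Finsupp.single p 1) (X q * g) := by
    rw [sub_mul, coeff_sub, add_comm s, coeff_X_mul]
  by_cases h0 : coeff (s + Finsupp.single p 1) (X q * g) = 0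
  · refine h _ ?_
    rw [mem_support_iff, hcoeff, h0, sub_zero]
    exact mem_support_iff.mp hs
  · rw [coeff_X_mul'] at h0
    split_ifs at h0 with hq
    · by_contra hnot
      have := hmax (s + Finsupp.single p 1 - Finsupp.single q 1)
        (Finset.mem_filter.mpr ⟨mem_support_iff.mpr h0,
          fun ⟨t, htA, ht⟩ => hnot ⟨t, htA, ht.trans tsub_le_self⟩⟩)
      simp [Finsupp.single_eq_of_ne hpq] at this
    · exact absurd rfl h0

theorem sub_algHom_mem_of_forall_X {σ R : Type*} [CommRing R]
    {φ : MvPolynomial σ R →ₐ[R] MvPolynomial σ R} {I : Ideal (MvPolynomial σ R)}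
    (h : ∀ p, X p - φ (X p) ∈ I) (f : MvPolynomial σ R) : f - φ f ∈ I := by
  rw [← Ideal.Quotient.mk_eq_mk_iff_sub_mem]
  have : Ideal.Quotient.mkₐ R I = (Ideal.Quotient.mkₐ R I).comp φ :=
    MvPolynomial.algHom_ext fun p => (Ideal.Quotient.mk_eq_mk_iff_sub_mem _ _).mpr (h p)
  exact DFunLike.congr_fun this f

variable {K : Type} [Field K] {v : ℕ} {n : Fin v → ℕ}

local notation "S" => MvPolynomial (MVar v n) K

open Classical in
/-- The substitution `x_{i j} ↦ x_{i 1}` for the variables `x_{i j}` in `Q`. -/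
def collapse (Q : Set (MVar v n)) : S →ₐ[K] S :=
  aeval fun p => if p ∈ Q then X ⟨p.1, 0⟩ else X p

theorem collapse_X_of_mem {Q : Set (MVar v n)} {p : MVar v n} (hp : p ∈ Q) :
    collapse Q (X p : S) = X ⟨p.1, 0⟩ := by
  simp [collapse, hp]

theorem collapse_X_of_notMem {Q : Set (MVar v n)} {p : MVar v n} (hp : p ∉ Q) :
    collapse Q (X p : S) = X p := by
  simp [collapse, hp]

theorem collapse_X_zero (Q : Set (MVar v n)) (i : Fin v) :
    collapse Q (X ⟨i, 0⟩ : S) = X ⟨i, 0⟩ := by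
  by_cases h : (⟨i, 0⟩ : MVar v n) ∈ Q
  · exact collapse_X_of_mem h
  · exact collapse_X_of_notMem h

theorem collapse_empty : collapse (∅ : Set (MVar v n)) = AlgHom.id K S :=
  MvPolynomial.algHom_ext fun p => collapse_X_of_notMem (Set.notMem_empty p)

theorem collapse_comp_collapse (Q Q' : Set (MVar v n)) :
    (collapse Q : S →ₐ[K] S).comp (collapse Q') = collapse (Q ∪ Q') := by
  refine MvPolynomial.algHom_ext fun p => ?_
  rw [AlgHom.comp_apply]
  by_cases h' : p ∈ Q'
  · rw [collapse_X_of_mem h', collapse_X_zero, collapse_X_of_mem (Or.inr h')]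
  · rw [collapse_X_of_notMem h']
    by_cases h : p ∈ Q
    · rw [collapse_X_of_mem h, collapse_X_of_mem (Or.inl h)]
    · rw [collapse_X_of_notMem h, collapse_X_of_notMem (by simp [h, h'])]

theorem monomial_Tmono (a : Fin v → ℕ) :
    (monomial (Tmono v n a) 1 : S) = ∏ i, X ⟨i, 0⟩ ^ a i := by
  simp only [Tmono, X_pow_eq_monomial]
  exact (monomial_sum_one _ _)

theorem Tmono_apply_eq_zero (a : Fin v → ℕ) {p : MVar v n} (hp : p.2 ≠ 0) :
    Tmono v n a p = 0 := by
  rw [Tmono, Finsupp.finsetSum_apply]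
  refine Finset.sum_eq_zero fun i _ => Finsupp.single_eq_of_ne ?_
  rintro rfl
  exact hp rfl

theorem collapse_univ_monomial (s : MVar v n →₀ ℕ) :
    collapse Set.univ (monomial s 1 : S) =
      monomial (Tmono v n (Finsupp.weight (wt v n) s)) 1 := by
  rw [monomial_Tmono, monomial_eq, C_1, one_mul, Finsupp.prod_fintype _ _ (by simp), map_prod,
    Fintype.prod_sigma]
  refine Finset.prod_congr rfl fun i _ => ?_
  simp only [map_pow, collapse_X_of_mem (Set.mem_univ _), weight_wt_apply]
  rw [← Finset.prod_pow_eq_pow_sum]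

theorem ExtendedFromT.le_comap_collapse {C : Ideal S} (hC : ExtendedFromT C)
    (Q : Set (MVar v n)) : C ≤ C.comap (collapse Q) := by
  obtain ⟨A, rfl⟩ := hC
  refine Ideal.span_le.mpr ?_
  rintro _ ⟨a, ha, rfl⟩
  rw [SetLike.mem_coe, Ideal.mem_comap]
  have : collapse Q (monomial (Tmono v n a) 1 : S) = monomial (Tmono v n a) 1 := by
    simp only [monomial_Tmono, map_prod, map_pow, collapse_X_zero]
  rw [this]
  exact Ideal.subset_span ⟨a, ha, rfl⟩

theorem ExtendedFromT.isMonomialIdeal {C : Ideal S} (hC : ExtendedFromT C) :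
    IsMonomialIdeal C := by
  obtain ⟨A, rfl⟩ := hC
  exact ⟨Tmono v n '' A, by rw [Set.image_image]⟩

theorem ExtendedFromT.mem_of_X_sub_X_mul_mem {C : Ideal S} (hC : ExtendedFromT C)
    {p : MVar v n} (hp : p.2 ≠ 0) {g : S} (h : (X p - X ⟨p.1, 0⟩) * g ∈ C) : g ∈ C := by
  obtain ⟨A, rfl⟩ := hC
  rw [← Set.image_image (fun s => monomial s (1 : K)) (Tmono v n) A] at h ⊢
  refine mem_span_monomial_of_X_sub_X_mul_mem (fun hpq => hp ?_) ?_ h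
  · rw [hpq]
  · rintro _ ⟨a, -, rfl⟩
    exact Tmono_apply_eq_zero a hp

theorem collapse_collapse (Q Q' : Set (MVar v n)) (f : S) :
    collapse Q (collapse Q' f) = collapse (Q ∪ Q') f :=
  DFunLike.congr_fun (collapse_comp_collapse Q Q') f

theorem sub_collapse_singleton_mem (p : MVar v n) (f : S) :
    f - collapse {p} f ∈ Ideal.span {(X p - X ⟨p.1, 0⟩ : S)} := by
  refine sub_algHom_mem_of_forall_X (fun q => ?_) f
  by_cases hq : q = p
  · subst hq
    rw [collapse_X_of_mem (Set.mem_singleton q)]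
    exact Ideal.mem_span_singleton_self _
  · rw [collapse_X_of_notMem (by simpa using hq), sub_self]
    exact zero_mem _

theorem ExtendedFromT.comap_collapse_sup_span {C : Ideal S} (hC : ExtendedFromT C)
    (Q : Set (MVar v n)) (p : MVar v n) :
    C.comap (collapse Q) ⊔ Ideal.span {X p - X ⟨p.1, 0⟩} = C.comap (collapse (Q ∪ {p})) := by
  apply le_antisymm
  · refine sup_le (fun f hf => ?_) ?_
    · rw [Ideal.mem_comap] at hf ⊢
      rw [Set.union_comm, ← collapse_collapse]
      exact Ideal.mem_comap.mp (hC.le_comap_collapse {p} hf)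
    · rw [Ideal.span_singleton_le_iff_mem, Ideal.mem_comap, map_sub,
        collapse_X_of_mem (Set.mem_union_right _ (Set.mem_singleton p)), collapse_X_zero, sub_self]
      exact zero_mem _
  · intro f hf
    rw [Ideal.mem_comap, ← collapse_collapse] at hf
    have := add_mem (Ideal.mem_sup_right (sub_collapse_singleton_mem p f))
      (Ideal.mem_sup_left (Ideal.mem_comap.mpr hf))
    rwa [sub_add_cancel] at this

theorem ExtendedFromT.isWeaklyRegular_comap_collapse {C : Ideal S} (hC : ExtendedFromT C)
    (ps : List (MVar v n)) (hps : ps.Nodup) (h0 : ∀ p ∈ ps, p.2 ≠ 0) :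
    ∀ Q : Set (MVar v n), (∀ p ∈ ps, p ∉ Q) →
      IsWeaklyRegular (S ⧸ C.comap (collapse Q)) (ps.map fun p => (X p - X ⟨p.1, 0⟩ : S)) := by
  induction ps with
  | nil => simp
  | cons p ps ih =>
    intro Q hQ
    rw [List.nodup_cons] at hps
    rw [List.map_cons, isWeaklyRegular_quotient_cons_iff, hC.comap_collapse_sup_span]
    refine ⟨fun g hg => ?_, ih hps.2 (fun q hq => h0 q (List.mem_cons_of_mem _ hq)) _ ?_⟩
    · rw [Ideal.mem_comap, map_mul, map_sub, collapse_X_zero,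
        collapse_X_of_notMem (hQ p List.mem_cons_self)] at hg
      exact hC.mem_of_X_sub_X_mul_mem (h0 p List.mem_cons_self) hg
    · rintro q hq (hq' | rfl)
      · exact hQ q (List.mem_cons_of_mem _ hq) hq'
      · exact hps.1 hq

variable (v n) in
/-- The variables `x_{i j}` with `j ≥ 2`, in the order used in `LamList`. -/
def nonFirstVars : List (MVar v n) :=
  (List.finRange v).flatMap fun i => ((List.finRange (n i + 1)).drop 1).map (Sigma.mk i)

theorem LamList_one :
    LamList (fun _ : MVar v n => (1 : K)) =
      (nonFirstVars v n).map fun p : MVar v n => X p - X ⟨p.1, 0⟩ := by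
  simp [LamList, nonFirstVars, List.map_flatMap, Function.comp_def]

theorem mem_nonFirstVars {p : MVar v n} : p ∈ nonFirstVars v n ↔ p.2 ≠ 0 := by
  obtain ⟨i, j⟩ := p
  simp only [nonFirstVars, List.finRange_succ, List.drop_one, List.tail_cons, List.map_map,
    List.mem_flatMap, List.mem_finRange, true_and, List.mem_map, Function.comp_apply]
  constructor
  · rintro ⟨i', k, h⟩
    cases h
    exact Fin.succ_ne_zero k
  · intro hj
    obtain ⟨k, rfl⟩ := Fin.exists_succ_eq.mpr hj
    exact ⟨i, k, rfl⟩

theorem nodup_nonFirstVars : (nonFirstVars v n).Nodup := by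
  refine List.nodup_flatMap.mpr ⟨fun i _ => ?_, ?_⟩
  · exact ((List.nodup_finRange _).sublist (List.drop_sublist _ _)).map sigma_mk_injective
  · refine (List.nodup_finRange v).imp fun {i i'} hne p hp hp' => hne ?_
    obtain ⟨_, _, rfl⟩ := List.mem_map.mp hp
    obtain ⟨_, _, h⟩ := List.mem_map.mp hp'
    exact (congrArg Sigma.fst h).symm

theorem ExtendedFromT.isWeaklyRegular_LamList {C : Ideal S} (hC : ExtendedFromT C) :
    IsWeaklyRegular (S ⧸ C) (LamList fun _ : MVar v n => (1 : K)) := by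
  have := hC.isWeaklyRegular_comap_collapse _ nodup_nonFirstVars
    (fun p hp => mem_nonFirstVars.mp hp) ∅ (by simp)
  rwa [← LamList_one, collapse_empty, show C.comap (AlgHom.id K S) = C from Ideal.comap_id C]
    at this

theorem LamList_one_ne_zero_and_isWeightedHomogeneous :
    ∀ l ∈ LamList fun _ : MVar v n => (1 : K),
      l ≠ 0 ∧ ∃ i, l.IsWeightedHomogeneous (wt v n) (Pi.single i 1) := by
  rw [LamList_one]
  intro l hl
  obtain ⟨p, hp, rfl⟩ := List.mem_map.mp hl
  refine ⟨fun h => mem_nonFirstVars.mp hp ?_, p.1, ?_⟩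
  · exact congrArg (fun q : MVar v n => (q.2 : ℕ)) (X_injective (sub_eq_zero.mp h)) |> Fin.ext
  · exact (isWeightedHomogeneous_X K (wt v n) p).sub
      (isWeightedHomogeneous_X K (wt v n) (⟨p.1, 0⟩ : MVar v n))

theorem monomial_sub_monomial_Tmono_mem (s : MVar v n →₀ ℕ) :
    (monomial s 1 - monomial (Tmono v n (Finsupp.weight (wt v n) s)) 1 : S) ∈
      Ideal.ofList (LamList fun _ : MVar v n => (1 : K)) := by
  rw [← collapse_univ_monomial]
  refine sub_algHom_mem_of_forall_X (fun p => ?_) _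
  rw [collapse_X_of_mem (Set.mem_univ p), LamList_one]
  by_cases hp : p.2 = 0
  · obtain ⟨i, j⟩ := p
    obtain rfl : j = 0 := hp
    simp
  · exact Ideal.subset_span (List.mem_map.mpr ⟨p, mem_nonFirstVars.mpr hp, rfl⟩)

theorem IsMonomialIdeal.monomial_mem {I : Ideal S} (hI : IsMonomialIdeal I) {f : S} (hf : f ∈ I)
    {s : MVar v n →₀ ℕ} (hs : s ∈ f.support) : (monomial s 1 : S) ∈ I := by
  obtain ⟨A, rfl⟩ := hI
  rw [mem_ideal_span_monomial_image] at hf ⊢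
  intro t ht
  rw [Finset.mem_singleton.mp (support_monomial_subset ht)]
  exact hf s hs

theorem IsMonomialIdeal.isMultigraded {I : Ideal S} (hI : IsMonomialIdeal I) :
    IsMultigraded I := by
  classical
  obtain ⟨A, rfl⟩ := hI
  intro f hf a
  rw [mem_ideal_span_monomial_image] at hf ⊢
  intro s hs
  rw [support_weightedHomogeneousComponent] at hs
  exact hf s (Finset.mem_filter.mp hs).1

theorem IsMonomialIdeal.hilb_ne_zero_iff {I : Ideal S} (hI : IsMonomialIdeal I)
    (a : Fin v → ℕ) :
    hilb I a ≠ 0 ↔ ∃ s, (monomial s 1 : S) ∈ I ∧ Finsupp.weight (wt v n) s = a := by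
  rw [hilb, Ne, Submodule.finrank_eq_zero, ← Ne, Submodule.ne_bot_iff]
  constructor
  · rintro ⟨f, ⟨hf, hfa⟩, hf0⟩
    obtain ⟨s, hs⟩ := support_nonempty.mpr hf0
    exact ⟨s, hI.monomial_mem hf hs, hfa (mem_support_iff.mp hs)⟩
  · rintro ⟨s, hs, hsa⟩
    exact ⟨monomial s 1, ⟨hs, isWeightedHomogeneous_monomial _ _ _ hsa⟩, by simp⟩

theorem le_sup_ofList_LamList_of_sameHS {I I' : Ideal S} (hI : IsMonomialIdeal I)
    (hI' : IsMonomialIdeal I') (h : sameHS I I') :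
    I ≤ I' ⊔ Ideal.ofList (LamList fun _ : MVar v n => (1 : K)) := by
  have hI2 := hI
  obtain ⟨A, rfl⟩ := hI
  refine Ideal.span_le.mpr ?_
  rintro _ ⟨s, hs, rfl⟩
  have h1 := (hI2.hilb_ne_zero_iff _).mpr ⟨s, Ideal.subset_span ⟨s, hs, rfl⟩, rfl⟩
  rw [h, hI'.hilb_ne_zero_iff] at h1
  obtain ⟨t, ht, hts⟩ := h1
  have := sub_mem (monomial_sub_monomial_Tmono_mem (K := K) s)
    (monomial_sub_monomial_Tmono_mem (K := K) t)
  rw [hts, sub_sub_sub_cancel_right] at this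
  change monomial s (1 : K) ∈ _
  rw [← add_sub_cancel (monomial t (1 : K)) (monomial s 1)]
  exact add_mem (Ideal.mem_sup_left ht) (Ideal.mem_sup_right this)

end Collapse

end CSPaper

/-- A monomial ideal `J` of `S` is Cartwright-Sturmfels* iff
`Γ = {x_{i j} - x_{i 1} : 1 ≤ i ≤ v, 2 ≤ j ≤ n_i}` is a regular sequence on `S/J`. -/
theorem monomial_CSstar_iff_regular_sequence
    {K : Type} [Field K] [Infinite K] {v : ℕ} {n : Fin v → ℕ}
    (J : Ideal (MvPolynomial (MVar v n) K)) (hJ : IsMonomialIdeal J) :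
    IsCSstar J ↔
      RingTheory.Sequence.IsWeaklyRegular (MvPolynomial (MVar v n) K ⧸ J)
        (LamList fun _ : MVar v n => (1 : K)) := by
  have key {C : Ideal (MvPolynomial (MVar v n) K)} (hC : ExtendedFromT C) :=
    fun h => (hilb_le_and_sameHS_iff_isWeaklyRegular _
      LamList_one_ne_zero_and_isWeightedHomogeneous hJ.isMultigraded
      hC.isMonomialIdeal.isMultigraded hC.isWeaklyRegular_LamList h).2
  constructor
  · rintro ⟨-, C, hC, hs⟩
    refine (key hC ?_).mp hs
    exact le_antisymm
      (sup_le (le_sup_ofList_LamList_of_sameHS hJ hC.isMonomialIdeal hs) le_sup_right)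
      (sup_le (le_sup_ofList_LamList_of_sameHS hC.isMonomialIdeal hJ fun a => (hs a).symm)
        le_sup_right)
  · intro hreg
    refine ⟨hJ.isMultigraded, ?_⟩
    obtain ⟨A, hA⟩ := hJ
    have hC : ExtendedFromT (Ideal.span
        ((fun a => (monomial (Tmono v n a) 1 : MvPolynomial (MVar v n) K)) ''
          (Finsupp.weight (wt v n) '' A))) := ⟨_, rfl⟩
    refine ⟨_, hC, (key hC ?_).mpr hreg⟩
    rw [Set.image_image, hA]
    refine le_antisymm (sup_le (Ideal.span_le.mpr ?_) le_sup_right)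
      (sup_le (Ideal.span_le.mpr ?_) le_sup_right) <;> rintro _ ⟨s, hs, rfl⟩
    · change monomial s (1 : K) ∈ _
      rw [← sub_add_cancel (monomial s (1 : K))
        (monomial (Tmono v n (Finsupp.weight (wt v n) s)) 1)]
      exact add_mem (Ideal.mem_sup_right (monomial_sub_monomial_Tmono_mem s))
        (Ideal.mem_sup_left (Ideal.subset_span ⟨s, hs, rfl⟩))
    · change monomial (Tmono v n (Finsupp.weight (wt v n) s)) (1 : K) ∈ _
      rw [← sub_sub_cancel (monomial s (1 : K))
        (monomial (Tmono v n (Finsupp.weight (wt v n) s)) 1)]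
      exact sub_mem (Ideal.mem_sup_left (Ideal.subset_span ⟨s, hs, rfl⟩))
        (Ideal.mem_sup_right (monomial_sub_monomial_Tmono_mem s))

end
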